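/- Let (Ω, F, P) be a probability space and H a real normed space. Let u : [0,∞) × Ω → H and let (τ_n)_{n∈ℕ} be a sequence of measurable maps τ_n : Ω → [0,∞] that is nondecreasing in n. Let V : H → ℝ be Borel measurable, and for R > 0 set q_R := inf{V(x) : x ∈ H, ‖x‖ ≥ R}. Assume: (1) V(x) ≥ 0 for all x ∈ H; (2) q_R → +∞ as R → ∞; (3) for every t ≥ 0 and n, the map ω ↦ u(t ∧ τ_n(ω), ω) is strongly measurable, ω ↦ V(u(t ∧ τ_n(ω), ω)) is integrable, s ↦ E[V(u(s ∧ τ_n))] is Borel measurable, and there is a constant C ≥ 0 (independent of n and t) with E[V(u(t ∧ τ_n))] ≤ E[V(u(0))] + C·∫₀ᵗ (1 + E[V(u(s ∧ τ_n))]) ds; (4) E[V(u(0))] < ∞; (5) for every n and t ≥ 0, for P-almost every ω with τ_n(ω) < t one has ‖u(t ∧ τ_n(ω), ω)‖ ≥ n. Then τ_∞ := lim_{n→∞} τ_n satisfies τ_∞ = +∞ P-almost surely, i.e. for P-almost every ω, sup_n τ_n(ω) = ∞. -/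

import Mathlib

open MeasureTheory
open scoped ENNReal

open Set Filter in
/-- Integral form of Grönwall's inequality for continuous functions. -/
theorem ContinuousOn.le_mul_exp_of_le_add_mul_integral {h : ℝ → ℝ} {K C t : ℝ}
    (hC : 0 ≤ C) (ht : 0 ≤ t) (hcont : ContinuousOn h (Icc 0 t))
    (hle : ∀ s ∈ Icc 0 t, h s ≤ K + C * ∫ r in (0 : ℝ)..s, h r) :
    h t ≤ K * Real.exp (C * t) := by
  have hii : IntervalIntegrable h volume 0 t := by
    apply ContinuousOn.intervalIntegrable
    rwa [uIcc_of_le ht]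
  have hderiv : ∀ x ∈ Ico 0 t,
      HasDerivWithinAt (fun s => K + C * ∫ r in (0 : ℝ)..s, h r) (C * h x) (Ici x) x := by
    intro x hx
    have hmem : Icc 0 t ∈ nhdsWithin x (Ioi x) :=
      mem_of_superset (Ioc_mem_nhdsGT hx.2) fun y hy => ⟨hx.1.trans hy.1.le, hy.2⟩
    have hx' : x ∈ Icc 0 t := ⟨hx.1, hx.2.le⟩
    have hii' : IntervalIntegrable h volume 0 x := by
      apply hii.mono_set
      rw [uIcc_of_le ht, uIcc_of_le hx.1]
      exact Icc_subset_Icc_right hx.2.le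
    have hmeas : StronglyMeasurableAtFilter h (nhdsWithin x (Ioi x)) volume :=
      ⟨Icc 0 t, hmem, hcont.aestronglyMeasurable measurableSet_Icc⟩
    exact ((intervalIntegral.integral_hasDerivWithinAt_right hii' hmeas
      ((hcont x hx').mono_of_mem_nhdsWithin hmem)).const_mul C).const_add K
  have hprim : ContinuousOn (fun s => K + C * ∫ r in (0 : ℝ)..s, h r) (Icc 0 t) := by
    have := intervalIntegral.continuousOn_primitive_interval' hii left_mem_uIcc
    rw [uIcc_of_le ht] at this
    exact (this.const_mul C).const_add K
  have hbound := le_gronwallBound_of_liminf_deriv_right_le (δ := K) (K := C) (ε := 0) hprim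
    (fun x hx r hr => (hderiv x hx).liminf_right_slope_le hr) (by simp)
    (fun x hx => by
      simpa using mul_le_mul_of_nonneg_left (hle x ⟨hx.1, hx.2.le⟩) hC) t ⟨ht, le_rfl⟩
  rw [gronwallBound_ε0, sub_zero] at hbound
  exact (hle t ⟨ht, le_rfl⟩).trans hbound

open Set in
/-- Integral form of Grönwall's inequality without any regularity assumption: where `g` is not
integrable its interval integral vanishes and the bound is immediate. -/
theorem le_mul_exp_of_le_add_mul_integral {g : ℝ → ℝ} {K C t : ℝ} (hK : 0 ≤ K)
    (hC : 0 ≤ C) (ht : 0 ≤ t)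
    (hle : ∀ s, 0 ≤ s → g s ≤ K + C * ∫ r in (0 : ℝ)..s, g r) :
    g t ≤ K * Real.exp (C * t) := by
  by_cases hg : IntervalIntegrable g volume 0 t
  · have hcont : ContinuousOn (fun s => K + C * ∫ r in (0 : ℝ)..s, g r) (Icc 0 t) := by
      have := intervalIntegral.continuousOn_primitive_interval' hg left_mem_uIcc
      rw [uIcc_of_le ht] at this
      exact (this.const_mul C).const_add K
    refine (hle t ht).trans (hcont.le_mul_exp_of_le_add_mul_integral hC ht fun s hs => ?_)
    have hsub : uIcc 0 s ⊆ Icc 0 t := by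
      rw [uIcc_of_le hs.1]
      exact Icc_subset_Icc_right hs.2
    gcongr
    refine intervalIntegral.integral_mono_on hs.1 (hg.mono_set (by rwa [uIcc_of_le ht]))
      (hcont.mono hsub).intervalIntegrable fun x hx => hle x hx.1
  · have h := hle t ht
    rw [intervalIntegral.integral_undef hg, mul_zero, add_zero] at h
    exact h.trans (le_mul_of_one_le_right hK (Real.one_le_exp (by positivity)))

/-- Khasminskii's test for nonexplosions (Lemma 4.4 of the paper): if `V` is a
nonnegative Lyapunov function with `q_R = inf {V x : ‖x‖ ≥ R} → ∞`, satisfying a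
Gronwall-type estimate along the stopped processes `u(· ∧ τ_n)`, with
`E[V(u(0))] < ∞`, and `‖u(t ∧ τ_n)‖ ≥ n` a.s. on `{τ_n < t}`, then
`τ_∞ = lim_n τ_n = ∞` almost surely. -/
theorem khasminskii_nonexplosion
    {Ω : Type*} [MeasurableSpace Ω] (P : Measure Ω) [IsProbabilityMeasure P]
    {H : Type*} [NormedAddCommGroup H] [MeasurableSpace H] [BorelSpace H]
    (u : ℝ → Ω → H) (τ : ℕ → Ω → ℝ≥0∞) (hτ : ∀ n, Measurable (τ n))
    (hτ_mono : ∀ ω : Ω, Monotone fun n : ℕ => τ n ω)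
    (V : H → ℝ) (hVmeas : Measurable V)
    (hVnonneg : ∀ x : H, 0 ≤ V x)
    (hq_tendsto : Filter.Tendsto (fun R : ℝ => sInf (V '' {x : H | R ≤ ‖x‖}))
      Filter.atTop Filter.atTop)
    (C : ℝ) (hC : 0 ≤ C)
    (hmeas : ∀ (n : ℕ) (t : ℝ), 0 ≤ t →
      AEStronglyMeasurable (fun ω => u ((min (ENNReal.ofReal t) (τ n ω)).toReal) ω) P)
    (hint : ∀ (n : ℕ) (t : ℝ), 0 ≤ t →
      Integrable (fun ω => V (u ((min (ENNReal.ofReal t) (τ n ω)).toReal) ω)) P)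
    (hmeas' : ∀ n : ℕ, Measurable fun s : ℝ =>
      ∫ ω, V (u ((min (ENNReal.ofReal s) (τ n ω)).toReal) ω) ∂P)
    (hgronwall : ∀ (n : ℕ) (t : ℝ), 0 ≤ t →
      (∫ ω, V (u ((min (ENNReal.ofReal t) (τ n ω)).toReal) ω) ∂P) ≤
        (∫ ω, V (u 0 ω) ∂P) +
          C * ∫ s in (0 : ℝ)..t,
            (1 + ∫ ω, V (u ((min (ENNReal.ofReal s) (τ n ω)).toReal) ω) ∂P))
    (hint0 : Integrable (fun ω => V (u 0 ω)) P)
    (hexit : ∀ (n : ℕ) (t : ℝ), 0 ≤ t →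
      ∀ᵐ ω ∂P, τ n ω < ENNReal.ofReal t →
        (n : ℝ) ≤ ‖u ((min (ENNReal.ofReal t) (τ n ω)).toReal) ω‖) :
    ∀ᵐ ω ∂P, (⨆ n : ℕ, τ n ω) = ∞ := by
  have hzero : ∀ t : ℝ, 0 ≤ t → P.real {ω | (⨆ n, τ n ω) < ENNReal.ofReal t} = 0 := by
    intro t ht
    set q : ℝ → ℝ := fun R => sInf (V '' {x : H | R ≤ ‖x‖}) with hq
    set p := P.real {ω | (⨆ n, τ n ω) < ENNReal.ofReal t} with hp
    set K := 1 + ∫ ω, V (u 0 ω) ∂P with hK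
    have hK0 : 0 ≤ K := add_nonneg zero_le_one (integral_nonneg fun ω => hVnonneg _)
    have hbound : ∀ n : ℕ, (∫ ω, V (u ((min (ENNReal.ofReal t) (τ n ω)).toReal) ω) ∂P) ≤
        K * Real.exp (C * t) := by
      intro n
      have h := le_mul_exp_of_le_add_mul_integral
        (g := fun s => 1 + ∫ ω, V (u ((min (ENNReal.ofReal s) (τ n ω)).toReal) ω) ∂P)
        hK0 hC ht fun s hs => by linarith [hgronwall n s hs]
      linarith
    have hmarkov : ∀ n : ℕ, 0 ≤ q n → q n * p ≤ K * Real.exp (C * t) := by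
      intro n hqn
      refine le_trans ?_ ((mul_meas_ge_le_integral_of_nonneg
        (Filter.Eventually.of_forall fun ω => hVnonneg _) (hint n t ht) (q n)).trans (hbound n))
      refine mul_le_mul_of_nonneg_left ?_ hqn
      refine ENNReal.toReal_mono (measure_ne_top _ _) (measure_mono_ae ?_)
      filter_upwards [hexit n t ht] with ω hω hlt
      refine csInf_le ⟨0, ?_⟩ ⟨_, hω ((le_iSup (fun n => τ n ω) n).trans_lt hlt), rfl⟩
      rintro _ ⟨x, -, rfl⟩
      exact hVnonneg x
    by_contra hne
    have hpos : 0 < p := lt_of_le_of_ne measureReal_nonneg (Ne.symm hne)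
    have hqt : Filter.Tendsto (fun n : ℕ => q n) Filter.atTop Filter.atTop :=
      hq_tendsto.comp tendsto_natCast_atTop_atTop
    obtain ⟨n, hn0, hn⟩ := ((hqt.eventually_ge_atTop 0).and
      ((hqt.atTop_mul_const hpos).eventually_gt_atTop (K * Real.exp (C * t)))).exists
    exact (hmarkov n hn0).not_gt hn
  have hae : ∀ k : ℕ, ∀ᵐ ω ∂P, ENNReal.ofReal k ≤ ⨆ n, τ n ω := by
    intro k
    have h := hzero k k.cast_nonneg
    rw [measureReal_eq_zero_iff] at h
    simpa only [ae_iff, not_le] using h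
  filter_upwards [ae_all_iff.2 hae] with ω hω
  exact ENNReal.eq_top_of_forall_nnreal_le fun r => by
    obtain ⟨k, hk⟩ := exists_nat_ge r
    refine le_trans ?_ (hω k)
    rw [ENNReal.ofReal_natCast]
    exact_mod_cast hk
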